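/- For every weak primary pseudoperfect number Q, the set 𝔑_Q has an asymptotic density δ(𝔑_Q), and δ(𝔑_Q) is strictly smaller than 1/𝔫_Q, where 𝔫_Q := lcm{(p-1)/gcd(p-1,Q) : p prime, p | Q} if Q ≠ 1 and 𝔫_Q := 1 if Q = 1. -/

import Mathlib

/-- The power sum `S m k = 1^m + 2^m + ⋯ + k^m`. -/
def S (m k : ℕ) : ℕ := ∑ i ∈ Finset.Icc 1 k, i ^ m

/-- The set `𝔑_Q` of positive integers `n` with `S_{Qn}(Qn) ≡ n (mod Qn)`. -/
def Nset (Q : ℕ) : Set ℕ := {n | 0 < n ∧ S (Q * n) (Q * n) ≡ n [MOD Q * n]}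

/-- The integer `𝔫_Q = lcm {(p-1)/gcd(p-1,Q) : prime p ∣ Q}` (which is `1` for `Q = 1`,
the lcm over the empty set). -/
def nQ (Q : ℕ) : ℕ := Q.primeFactors.lcm (fun p => (p - 1) / Nat.gcd (p - 1) Q)

/-- A set `A` of positive integers has asymptotic density `δ` if
`card (A ∩ [1, N]) / N → δ` as `N → ∞`. -/
def HasDensity (A : Set ℕ) (δ : ℝ) : Prop :=
  Filter.Tendsto (fun N : ℕ => ((A ∩ Set.Icc 1 N).ncard : ℝ) / N)
    Filter.atTop (nhds δ)

open Finset in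
theorem ZMod.sum_Ico_pow (p : ℕ) [Fact p.Prime] (m : ℕ) :
    ∑ v ∈ Ico 1 p, (v : ZMod p) ^ m = if p - 1 ∣ m then -1 else 0 := by
  have hbij : ∑ v ∈ Ico 1 p, (v : ZMod p) ^ m = ∑ u : (ZMod p)ˣ, (u : ZMod p) ^ m :=
    Finset.sum_bij'
      (fun v hv ↦ Units.mk0 (v : ZMod p) (mt (ZMod.natCast_eq_zero_iff v p).mp (by
        grind [Nat.not_dvd_of_pos_of_lt])))
      (fun u _ ↦ (u : ZMod p).val)
      (fun _ _ ↦ Finset.mem_univ _)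
      (fun u _ ↦ by grind [u.ne_zero, ZMod.val_ne_zero, ZMod.val_lt])
      (fun v hv ↦ by simp [ZMod.val_cast_of_lt (Finset.mem_Ico.mp hv).2])
      (fun u _ ↦ Units.ext (ZMod.natCast_zmod_val _))
      (fun _ _ ↦ rfl)
  rw [hbij, FiniteField.sum_pow_units, ZMod.card]

theorem prime_pow_dvd_pow_sub_pow {p k N : ℕ} {a b : ℤ} (hk : k ≠ 0) (hN : p ^ k ∣ N)
    (hab : (p : ℤ) ∣ a - b) : (p : ℤ) ^ k ∣ a ^ N - b ^ N := by
  obtain ⟨j, rfl⟩ := Nat.exists_eq_succ_of_ne_zero hk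
  obtain ⟨t, rfl⟩ := (pow_dvd_pow p j.le_succ).trans hN
  rw [pow_mul, pow_mul]
  exact (dvd_sub_pow_of_dvd_sub hab j).trans (sub_dvd_pow_sub_pow _ _ t)

theorem S_eq_sum_range (m k : ℕ) : S m k = ∑ i ∈ Finset.range k, (i + 1) ^ m := by
  induction k with
  | zero => simp [S]
  | succ k ih => rw [S, Finset.sum_Icc_succ_top (by omega), Finset.sum_range_succ, ← ih, S]

theorem prime_pow_dvd_S_mul_sub {p k N : ℕ} (hk : k ≠ 0) (hN : p ^ k ∣ N) (M : ℕ) :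
    (p : ℤ) ^ k ∣ S N (p * M) - M * S N p := by
  induction M with
  | zero => simp [S]
  | succ M ih =>
    have key : (p : ℤ) ^ k ∣ S N (p * (M + 1)) - S N (p * M) - S N p := by
      simp only [S_eq_sum_range, mul_add, mul_one, Finset.sum_range_add]
      push_cast
      rw [add_sub_cancel_left, ← Finset.sum_sub_distrib]
      refine Finset.dvd_sum fun i _ => prime_pow_dvd_pow_sub_pow hk hN ⟨M, by ring⟩
    refine (dvd_add ih key).trans (dvd_of_eq ?_)
    push_cast
    ring

theorem prime_dvd_S_add {p m : ℕ} (hp : p.Prime) (hm : m ≠ 0) :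
    (p : ℤ) ∣ S m p + if p - 1 ∣ m then 1 else 0 := by
  have := Fact.mk hp
  rw [← ZMod.intCast_zmod_eq_zero_iff_dvd, S, ← Finset.Ico_insert_right hp.one_le,
    Finset.sum_insert (by simp)]
  push_cast
  rw [ZMod.sum_Ico_pow]
  split_ifs <;> simp [hm]

/-- A local form of the von Staudt congruence for `S N N`. -/
theorem prime_pow_dvd_S_add {p k M : ℕ} (hp : p.Prime) (hk : k ≠ 0) (hM : M ≠ 0)
    (hN : p ^ k ∣ p * M) :
    (p : ℤ) ^ k ∣ S (p * M) (p * M) + if p - 1 ∣ p * M then M else 0 := by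
  have h1 := prime_pow_dvd_S_mul_sub hk hN M
  have h2 : (p : ℤ) ^ k ∣ M * (S (p * M) p + if p - 1 ∣ p * M then 1 else 0) := by
    obtain ⟨c, hc⟩ := prime_dvd_S_add hp (mul_ne_zero hp.ne_zero hM)
    rw [hc]
    have : (p : ℤ) ^ k ∣ p * M := by exact_mod_cast hN
    exact (this.mul_right c).trans (dvd_of_eq (by ring))
  refine (dvd_add h1 h2).trans (dvd_of_eq ?_)
  split_ifs <;> push_cast <;> ring

theorem dvd_div_add_one_of_weak {Q p : ℕ}
    (hw : (∑ p ∈ Q.primeFactors, Q / p) + 1 ≡ 0 [MOD Q]) (hp : p ∈ Q.primeFactors) :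
    p ∣ Q / p + 1 := by
  have h1 : p ∣ (∑ q ∈ Q.primeFactors, Q / q) + 1 :=
    (Nat.dvd_of_mem_primeFactors hp).trans ((Nat.modEq_zero_iff_dvd).1 hw)
  rw [← Finset.add_sum_erase _ _ hp, add_right_comm] at h1
  refine (Nat.dvd_add_left (Finset.dvd_sum fun q hq => ?_)).1 h1
  rw [Finset.mem_erase] at hq
  have hpp := Nat.prime_of_mem_primeFactors hp
  have hqp := Nat.prime_of_mem_primeFactors hq.2
  refine Nat.dvd_div_of_mul_dvd (Nat.Coprime.mul_dvd_of_dvd_of_dvd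
    ((Nat.coprime_primes hqp hpp).2 hq.1) (Nat.dvd_of_mem_primeFactors hq.2)
    (Nat.dvd_of_mem_primeFactors hp))

theorem mem_Nset_iff {Q : ℕ} (hQ : 0 < Q)
    (hw : (∑ p ∈ Q.primeFactors, Q / p) + 1 ≡ 0 [MOD Q]) {n : ℕ} (hn : 0 < n) :
    n ∈ Nset Q ↔ ∀ p, p.Prime → p ∣ Q * n → (p - 1 ∣ Q * n ↔ p ∣ Q) := by
  have hlocal : n ∈ Nset Q ↔ ∀ p k, p.Prime → k ≠ 0 → p ^ k ∣ Q * n →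
      p ^ k ∣ (if p - 1 ∣ Q * n then Q * n / p else 0) + n := by
    simp only [Nset, Set.mem_ofPred_eq, hn, true_and]
    rw [Nat.ModEq.comm, Nat.modEq_iff_dvd, ← Int.dvd_natAbs, Int.natCast_dvd_natCast,
      Nat.dvd_iff_prime_pow_dvd_dvd]
    refine forall₃_congr fun p k hp => ?_
    rcases eq_or_ne k 0 with rfl | hk
    · simp
    simp only [ne_eq, hk, not_false_eq_true, forall_const]
    refine forall_congr' fun hd => ?_
    obtain ⟨M, hM⟩ := (dvd_pow_self p hk).trans hd
    have hM0 : M ≠ 0 := by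
      rintro rfl
      simp [hQ.ne', hn.ne'] at hM
    have := prime_pow_dvd_S_add hp hk hM0 (hM ▸ hd)
    rw [hM, Nat.mul_div_cancel_left _ hp.pos, ← Int.natCast_dvd_natCast, Int.dvd_natAbs,
      ← Int.natCast_dvd_natCast]
    rw [Nat.cast_pow, ← dvd_sub_right this, add_sub_sub_cancel, Nat.cast_add]
  rw [hlocal]
  constructor
  · intro h p hp hpN
    have hN0 : Q * n ≠ 0 := (Nat.mul_pos hQ hn).ne'
    have hk := (hp.factorization_pos_of_dvd hN0 hpN).ne'
    have hd := Nat.ordProj_dvd (Q * n) p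
    have hsucc := Nat.pow_succ_factorization_not_dvd hN0 hp
    set k := (Q * n).factorization p
    have h1 := h p k hp hk hd
    constructor
    · intro h2
      by_contra hpQ
      rw [if_pos h2] at h1
      have h3 : p ^ k ∣ n :=
        ((hp.coprime_iff_not_dvd.2 hpQ).pow_left k).dvd_of_dvd_mul_left hd
      refine hsucc ?_
      rw [pow_succ, ← Nat.div_mul_cancel hpN]
      exact mul_dvd_mul_right ((Nat.dvd_add_left h3).1 h1) p
    · intro hpQ
      by_contra h2
      rw [if_neg h2, zero_add] at h1
      refine hsucc ?_
      rw [pow_succ']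
      exact mul_dvd_mul hpQ h1
  · intro h p k hp hk hd
    have hpN := (dvd_pow_self p hk).trans hd
    have h1 := h p hp hpN
    split_ifs with h2
    · have hpQ := h1.1 h2
      have hdiv := dvd_div_add_one_of_weak hw (Nat.mem_primeFactors.2 ⟨hp, hpQ, hQ.ne'⟩)
      rw [Nat.mul_div_right_comm hpQ]
      obtain ⟨R, rfl⟩ := hpQ
      rw [Nat.mul_div_cancel_left _ hp.pos] at *
      obtain ⟨j, rfl⟩ := Nat.exists_eq_succ_of_ne_zero hk
      have hcop : p.Coprime R := by
        refine hp.coprime_iff_not_dvd.2 fun hR => hp.one_lt.ne' ?_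
        exact Nat.dvd_one.1 ((Nat.dvd_add_right hR).1 hdiv)
      have hj : p ^ j ∣ n := by
        rw [Nat.succ_eq_add_one, pow_succ', mul_assoc] at hd
        exact (hcop.pow_left j).dvd_of_dvd_mul_left (Nat.dvd_of_mul_dvd_mul_left hp.pos hd)
      rw [Nat.succ_eq_add_one, pow_succ, ← Nat.add_one_mul, mul_comm (R + 1)]
      exact mul_dvd_mul hj hdiv
    · rw [zero_add]
      have hpQ := fun h => h2 (h1.2 h)
      exact ((hp.coprime_iff_not_dvd.2 hpQ).pow_left k).dvd_of_dvd_mul_left hd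

theorem dvd_mul_iff_div_gcd_dvd {a Q n : ℕ} (ha : 0 < a) :
    a ∣ Q * n ↔ a / a.gcd Q ∣ n := by
  have hg := Nat.gcd_pos_of_pos_left Q ha
  constructor
  · intro h
    refine (Nat.coprime_div_gcd_div_gcd hg).dvd_of_dvd_mul_left ?_
    rw [Nat.div_mul_right_comm (Nat.gcd_dvd_right a Q)]
    exact Nat.div_dvd_div (Nat.gcd_dvd_left a Q) h
  · rintro h
    rw [← Nat.mul_div_cancel' (Nat.gcd_dvd_left a Q)]
    exact mul_dvd_mul (Nat.gcd_dvd_right a Q) h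

open Classical in
/-- For a prime `p` not dividing `Q`, the integer such that `p` divides `Q * n` and `p - 1` divides
`Q * n` if and only if it divides `n`; it is `0` for all other `p`. -/
noncomputable def obstruction (Q p : ℕ) : ℕ :=
  if p.Prime ∧ ¬ p ∣ Q then p * ((p - 1) / (p - 1).gcd Q) else 0

theorem obstruction_dvd_iff {Q p n : ℕ} (hp : p.Prime) (hpQ : ¬ p ∣ Q) :
    obstruction Q p ∣ n ↔ p ∣ Q * n ∧ p - 1 ∣ Q * n := by
  have h1 : 0 < p - 1 := Nat.sub_pos_of_lt hp.one_lt
  have hcop : p.Coprime ((p - 1) / (p - 1).gcd Q) := by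
    refine Nat.Coprime.coprime_dvd_right (Nat.div_dvd_of_dvd (Nat.gcd_dvd_left _ _)) ?_
    exact hp.coprime_iff_not_dvd.2 (Nat.not_dvd_of_pos_of_lt h1 (by omega))
  rw [obstruction, if_pos ⟨hp, hpQ⟩, dvd_mul_iff_div_gcd_dvd h1,
    (hp.coprime_iff_not_dvd.2 hpQ).dvd_mul_left]
  exact ⟨fun h => ⟨(dvd_mul_right _ _).trans h, (dvd_mul_left _ _).trans h⟩,
    fun h => hcop.mul_dvd_of_dvd_of_dvd h.1 h.2⟩

theorem mem_Nset_iff_dvd {Q : ℕ} (hQ : 0 < Q)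
    (hw : (∑ p ∈ Q.primeFactors, Q / p) + 1 ≡ 0 [MOD Q]) {n : ℕ} (hn : 0 < n) :
    n ∈ Nset Q ↔ nQ Q ∣ n ∧ ∀ p, ¬ obstruction Q p ∣ n := by
  rw [mem_Nset_iff hQ hw hn, nQ, Finset.lcm_dvd_iff]
  constructor
  · refine fun h => ⟨fun p hp => ?_, fun p hd => ?_⟩
    · have hp' := Nat.prime_of_mem_primeFactors hp
      have hpQ := Nat.dvd_of_mem_primeFactors hp
      rw [← dvd_mul_iff_div_gcd_dvd (Nat.sub_pos_of_lt hp'.one_lt)]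
      exact (h p hp' (hpQ.mul_right n)).2 hpQ
    · by_cases hp : p.Prime ∧ ¬ p ∣ Q
      · rw [obstruction_dvd_iff hp.1 hp.2] at hd
        exact hp.2 ((h p hp.1 hd.1).1 hd.2)
      · rw [obstruction, if_neg hp, zero_dvd_iff] at hd
        exact hn.ne' hd
  · rintro ⟨h1, h2⟩ p hp hpN
    refine ⟨fun h => ?_, fun hpQ => ?_⟩
    · by_contra hpQ
      exact h2 p ((obstruction_dvd_iff hp hpQ).2 ⟨hpN, h⟩)
    · rw [dvd_mul_iff_div_gcd_dvd (Nat.sub_pos_of_lt hp.one_lt)]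
      exact h1 p (Nat.mem_primeFactors.2 ⟨hp, hpQ, hQ.ne'⟩)

theorem obstruction_ne_zero {Q p : ℕ} (hp : p.Prime) (hpQ : ¬ p ∣ Q) : obstruction Q p ≠ 0 := by
  rw [obstruction, if_pos ⟨hp, hpQ⟩]
  refine mul_ne_zero hp.ne_zero ?_
  have h1 : 0 < p - 1 := Nat.sub_pos_of_lt hp.one_lt
  exact (Nat.div_pos (Nat.gcd_le_left _ h1) (Nat.gcd_pos_of_pos_left _ h1)).ne'

theorem le_obstruction {Q p : ℕ} (h : obstruction Q p ≠ 0) : p ≤ obstruction Q p := by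
  unfold obstruction at *
  split_ifs at * with hp
  · exact Nat.le_mul_of_pos_right p (Nat.pos_of_ne_zero (right_ne_zero_of_mul h))
  · exact absurd rfl h

theorem sq_le_mul_obstruction {Q p : ℕ} (hQ : 0 < Q) (h : obstruction Q p ≠ 0) :
    p ^ 2 ≤ 2 * Q * obstruction Q p := by
  unfold obstruction at *
  split_ifs at * with hp
  · have h1 : (p - 1) ≤ Q * ((p - 1) / (p - 1).gcd Q) := by
      conv_lhs => rw [← Nat.mul_div_cancel' (Nat.gcd_dvd_left (p - 1) Q)]
      exact Nat.mul_le_mul_right _ (Nat.gcd_le_right _ hQ)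
    have h2 := hp.1.two_le
    have h3 : p ≤ 2 * (Q * ((p - 1) / (p - 1).gcd Q)) := by omega
    calc p ^ 2 = p * p := sq p
      _ ≤ p * (2 * (Q * ((p - 1) / (p - 1).gcd Q))) := Nat.mul_le_mul_left p h3
      _ = _ := by ring
  · exact absurd rfl h

theorem summable_inv_obstruction {Q : ℕ} (hQ : 0 < Q) :
    Summable fun p => ((obstruction Q p : ℝ))⁻¹ := by
  refine Summable.of_nonneg_of_le (fun _ => by positivity) (fun p => ?_)
    ((Real.summable_nat_pow_inv.2 one_lt_two).mul_left (2 * Q : ℝ))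
  rcases eq_or_ne (obstruction Q p) 0 with h | h
  · rw [h]
    simp only [Nat.cast_zero, inv_zero]
    positivity
  · have hp : p ≠ 0 := by
      rintro rfl
      simp [obstruction] at h
    have h1 : (p : ℝ) ^ 2 ≤ 2 * Q * obstruction Q p := by
      exact_mod_cast sq_le_mul_obstruction hQ h
    have h2 : (0 : ℝ) < p := by positivity
    have h3 : (0 : ℝ) < obstruction Q p := by positivity
    rw [← div_eq_mul_inv, le_div_iff₀ (by positivity), inv_mul_le_iff₀ h3]
    linarith

theorem nQ_pos (Q : ℕ) : 0 < nQ Q := by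
  refine Nat.pos_of_ne_zero fun h => ?_
  rw [nQ, Finset.lcm_eq_zero_iff] at h
  obtain ⟨p, hp, h⟩ := h
  have h1 : 0 < p - 1 := Nat.sub_pos_of_lt (Nat.prime_of_mem_primeFactors hp).one_lt
  exact (Nat.div_pos (Nat.gcd_le_left _ h1) (Nat.gcd_pos_of_pos_left _ h1)).ne' h

open Filter Topology in
theorem tendsto_div_of_add_period {c : ℕ → ℝ} {m : ℕ} {C : ℝ} (hm : 0 < m)
    (h : ∀ N, c (N + m) = c N + C) : Tendsto (fun N : ℕ => c N / N) atTop (𝓝 (C / m)) := by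
  set g : ℕ → ℝ := fun N => c N - N * (C / m) with hg
  have hm' : (m : ℝ) ≠ 0 := by positivity
  have hper : Function.Periodic g m := fun N => by
    simp only [hg, h]
    push_cast
    field_simp
    ring
  have hbound : ∀ N, |g N| ≤ ∑ r ∈ Finset.range m, |g r| := fun N => by
    rw [← hper.map_mod_nat N]
    exact Finset.single_le_sum (f := fun r => |g r|) (fun _ _ => abs_nonneg _)
      (Finset.mem_range.2 (Nat.mod_lt N hm))
  have hzero : Tendsto (fun N : ℕ => g N / N) atTop (𝓝 0) := by
    refine squeeze_zero_norm (fun N => ?_) (tendsto_const_div_atTop_nhds_zero_nat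
      (∑ r ∈ Finset.range m, |g r|))
    rw [Real.norm_eq_abs, abs_div, Nat.abs_cast]
    exact div_le_div_of_nonneg_right (hbound N) (Nat.cast_nonneg N)
  have hsum := hzero.add_const (C / m)
  rw [zero_add] at hsum
  refine hsum.congr' ?_
  filter_upwards [eventually_gt_atTop 0] with N hN
  have hN' : (N : ℝ) ≠ 0 := by positivity
  simp only [hg]
  field_simp
  ring

theorem ncard_inter_Icc (P : ℕ → Prop) [DecidablePred P] (N : ℕ) :
    ({n | P n} ∩ Set.Icc 1 N).ncard = (Finset.filter P (Finset.Icc 1 N)).card := by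
  rw [← Set.ncard_coe_finset]
  congr 1
  ext n
  simp [and_comm]

theorem ncard_dvd_inter_Icc (a N : ℕ) : ({n | a ∣ n} ∩ Set.Icc 1 N).ncard = N / a := by
  rw [ncard_inter_Icc, ← Nat.Ioc_filter_dvd_card_eq_div]
  rfl

theorem HasDensity.of_periodic {P : ℕ → Prop} {m : ℕ} (hm : 0 < m)
    (hP : Function.Periodic P m) : ∃ δ, HasDensity {n | P n} δ := by
  classical
  refine ⟨_, tendsto_div_of_add_period (C := Nat.count P m) hm fun N => ?_⟩
  rw [← Nat.filter_Ico_card_eq_of_periodic (N + 1) m P hP]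
  simp only [ncard_inter_Icc]
  rw [← Nat.cast_add, ← Finset.card_union_of_disjoint]
  · rw [← Finset.filter_union]
    congr 3
    ext x
    simp only [Finset.mem_Icc, Finset.mem_union, Finset.mem_Ico]
    omega
  · refine Finset.disjoint_filter_filter (Finset.disjoint_left.2 fun x hx hx' => ?_)
    simp only [Finset.mem_Icc, Finset.mem_Ico] at hx hx'
    omega

theorem finite_inter_Icc (A : Set ℕ) (N : ℕ) : (A ∩ Set.Icc 1 N).Finite :=
  (Set.finite_Icc 1 N).subset Set.inter_subset_right

theorem HasDensity.mono {A B : Set ℕ} {α β : ℝ} (hA : HasDensity A α) (hB : HasDensity B β)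
    (h : A ⊆ B) : α ≤ β := by
  refine le_of_tendsto_of_tendsto' hA hB fun N => ?_
  gcongr
  exact finite_inter_Icc B N

theorem HasDensity.nonneg {A : Set ℕ} {α : ℝ} (hA : HasDensity A α) : 0 ≤ α :=
  ge_of_tendsto' hA fun N => by positivity

/-- The multiples of `a` that are divisible by none of the positive terms among the first `K` terms
of `d`. -/
def sieve (a : ℕ) (d : ℕ → ℕ) (K : ℕ) : Set ℕ :=
  {n | a ∣ n ∧ ∀ i < K, d i ≠ 0 → ¬ d i ∣ n}

theorem exists_hasDensity_sieve {a : ℕ} (ha : 0 < a) (d : ℕ → ℕ) (K : ℕ) :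
    ∃ δ, HasDensity (sieve a d K) δ := by
  set m := a * ∏ i ∈ Finset.range K, if d i = 0 then 1 else d i with hm
  refine HasDensity.of_periodic (m := m) ?_ fun n => ?_
  · refine Nat.mul_pos ha (Finset.prod_pos fun i _ => ?_)
    split_ifs <;> omega
  · have hdvd : ∀ i < K, d i ≠ 0 → d i ∣ m := fun i hi h0 => by
      refine Dvd.dvd.mul_left ?_ a
      have := Finset.dvd_prod_of_mem (fun i => if d i = 0 then 1 else d i)
        (Finset.mem_range.2 hi)
      rwa [if_neg h0] at this
    refine propext (and_congr (Nat.dvd_add_left (dvd_mul_right _ _)) ?_)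
    exact forall₃_congr fun i hi h0 => not_congr (Nat.dvd_add_left (hdvd i hi h0))

theorem sieve_antitone (a : ℕ) (d : ℕ → ℕ) : Antitone (sieve a d) :=
  fun _ _ h _ hn => ⟨hn.1, fun i hi => hn.2 i (hi.trans_le h)⟩

/-- The positive multiples of `a` that are divisible by no term of `d`. -/
def sifted (a : ℕ) (d : ℕ → ℕ) : Set ℕ := {n | 0 < n ∧ a ∣ n ∧ ∀ i, ¬ d i ∣ n}

theorem sifted_subset_sieve (a : ℕ) (d : ℕ → ℕ) (K : ℕ) : sifted a d ⊆ sieve a d K :=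
  fun _ hn => ⟨hn.2.1, fun i _ _ => hn.2.2 i⟩

theorem ncard_sieve_le {a : ℕ} {d : ℕ → ℕ} (hd : ∀ i, d i ≠ 0 → i ≤ d i) (K N : ℕ) :
    (sieve a d K ∩ Set.Icc 1 N).ncard ≤
      (sifted a d ∩ Set.Icc 1 N).ncard + ∑ i ∈ Finset.Ico K (N + 1), N / d i := by
  classical
  have hsub : sieve a d K ∩ Set.Icc 1 N ⊆ (sifted a d ∩ Set.Icc 1 N) ∪
      ((Finset.Ico K (N + 1)).biUnion fun i => Finset.filter (d i ∣ ·) (Finset.Ioc 0 N) :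
        Finset ℕ) := by
    rintro n ⟨hn, hN⟩
    by_cases h : ∀ i, ¬ d i ∣ n
    · exact Or.inl ⟨⟨hN.1, hn.1, h⟩, hN⟩
    · push Not at h
      obtain ⟨i, hi⟩ := h
      have h0 : d i ≠ 0 := by
        intro h0
        rw [h0, zero_dvd_iff] at hi
        exact absurd hN.1 (by omega)
      have hle := (hd i h0).trans ((Nat.le_of_dvd hN.1 hi).trans hN.2)
      have hKi : K ≤ i := not_lt.1 fun hlt => hn.2 i hlt h0 hi
      right
      simp only [Finset.coe_biUnion, Set.mem_iUnion, Finset.mem_coe, Finset.mem_filter,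
        Finset.mem_Ioc, Finset.mem_Ico]
      exact ⟨i, ⟨hKi, by omega⟩, ⟨hN.1, hN.2⟩, hi⟩
  refine (Set.ncard_le_ncard hsub ((finite_inter_Icc _ N).union (Finset.finite_toSet _))).trans
    ((Set.ncard_union_le _ _).trans (Nat.add_le_add_left ?_ _))
  rw [Set.ncard_coe_finset]
  exact Finset.card_biUnion_le.trans_eq
    (Finset.sum_congr rfl fun i _ => Nat.Ioc_filter_dvd_card_eq_div N (d i))

theorem sieve_density_sub_le {a : ℕ} {d : ℕ → ℕ} (hd : ∀ i, d i ≠ 0 → i ≤ d i)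
    (hs : Summable fun i => (d i : ℝ)⁻¹) (K N : ℕ) :
    ((sieve a d K ∩ Set.Icc 1 N).ncard : ℝ) / N - ((sifted a d ∩ Set.Icc 1 N).ncard : ℝ) / N ≤
      ∑' i, (d (i + K) : ℝ)⁻¹ := by
  have htail : ∑ i ∈ Finset.Ico K (N + 1), (d i : ℝ)⁻¹ ≤ ∑' i, (d (i + K) : ℝ)⁻¹ := by
    rw [Finset.sum_Ico_eq_sum_range]
    simp only [add_comm K]
    exact ((summable_nat_add_iff K).2 hs).sum_le_tsum _ fun i _ => by positivity
  rcases Nat.eq_zero_or_pos N with rfl | hN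
  · simpa using tsum_nonneg fun i => by positivity
  have hN' : (0 : ℝ) < N := by positivity
  rw [← sub_div, div_le_iff₀ hN', sub_le_iff_le_add']
  refine (Nat.cast_le.2 (ncard_sieve_le hd K N)).trans ?_
  push_cast
  gcongr
  refine le_trans ?_ (mul_le_mul_of_nonneg_right htail hN'.le)
  rw [Finset.sum_mul]
  refine Finset.sum_le_sum fun i _ => Nat.cast_div_le.trans_eq ?_
  rw [div_eq_mul_inv, mul_comm]

open Filter Topology in
theorem exists_hasDensity_sifted {a : ℕ} (ha : 0 < a) {d : ℕ → ℕ} (hd : ∀ i, d i ≠ 0 → i ≤ d i)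
    (hs : Summable fun i => (d i : ℝ)⁻¹) : ∃ δ, HasDensity (sifted a d) δ := by
  choose L hL using exists_hasDensity_sieve ha d
  have hanti : Antitone L := fun i j hij => (hL j).mono (hL i) (sieve_antitone a d hij)
  have hbdd : BddBelow (Set.range L) := ⟨0, by rintro _ ⟨i, rfl⟩; exact (hL i).nonneg⟩
  refine ⟨_, TendstoUniformlyOnFilter.tendsto_of_eventually_tendsto (p := atTop)
    (F := fun K N => ((sieve a d K ∩ Set.Icc 1 N).ncard : ℝ) / N) ?_ (.of_forall hL)
    (tendsto_atTop_ciInf hanti hbdd)⟩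
  refine TendstoUniformlyOn.tendstoUniformlyOnFilter (s := Set.univ) ?_ |>.mono_right (by simp)
  rw [Metric.tendstoUniformlyOn_iff]
  intro ε hε
  filter_upwards [(tendsto_sum_nat_add fun i => (d i : ℝ)⁻¹).eventually_lt_const hε] with K hK N _
  rw [dist_comm, Real.dist_eq, abs_of_nonneg]
  · exact (sieve_density_sub_le hd hs K N).trans_lt hK
  · rw [sub_nonneg]
    gcongr
    · exact finite_inter_Icc _ N
    · exact sifted_subset_sieve a d K

open Filter Topology in
theorem HasDensity.lt_of_sifted {a : ℕ} (ha : 0 < a) {d : ℕ → ℕ} {i : ℕ} (hi : d i ≠ 0) {δ : ℝ}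
    (h : HasDensity (sifted a d) δ) : δ < 1 / a := by
  set l := a * d i with hl
  have hd : 0 < d i := Nat.pos_of_ne_zero hi
  have hl0 : 0 < l := Nat.mul_pos ha hd
  have hcount : ∀ t, (sifted a d ∩ Set.Icc 1 (l * t)).ncard + t ≤ d i * t := fun t => by
    have hsub : ({n | l ∣ n} ∩ Set.Icc 1 (l * t)) ∪ (sifted a d ∩ Set.Icc 1 (l * t)) ⊆
        {n | a ∣ n} ∩ Set.Icc 1 (l * t) := by
      rintro n (hn | hn)
      · exact ⟨(dvd_mul_right a _).trans hn.1, hn.2⟩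
      · exact ⟨hn.1.2.1, hn.2⟩
    have hdisj : Disjoint ({n | l ∣ n} ∩ Set.Icc 1 (l * t)) (sifted a d ∩ Set.Icc 1 (l * t)) :=
      Set.disjoint_left.2 fun n hn hn' => hn'.1.2.2 i ((dvd_mul_left _ a).trans hn.1)
    have := Set.ncard_le_ncard hsub (finite_inter_Icc _ _)
    rw [Set.ncard_union_eq hdisj (finite_inter_Icc _ _) (finite_inter_Icc _ _),
      ncard_dvd_inter_Icc, ncard_dvd_inter_Icc, Nat.mul_div_cancel_left _ hl0, hl, mul_assoc,
      Nat.mul_div_cancel_left _ ha, ← mul_assoc, ← hl] at this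
    omega
  have ha' : (0 : ℝ) < a := by positivity
  have hd' : (0 : ℝ) < d i := by positivity
  have hlim : Tendsto (fun t : ℕ => l * t) atTop atTop := tendsto_id.const_mul_atTop' hl0
  have hle : δ ≤ 1 / a - 1 / l := by
    refine le_of_tendsto (h.comp hlim) ?_
    filter_upwards [eventually_gt_atTop 0] with t ht
    have ht' : (0 : ℝ) < t := by positivity
    have hc : ((sifted a d ∩ Set.Icc 1 (l * t)).ncard : ℝ) + t ≤ d i * t := by
      exact_mod_cast hcount t
    have hl' : (0 : ℝ) < l := by positivity
    simp only [Function.comp_apply, Nat.cast_mul]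
    rw [div_le_iff₀ (by positivity)]
    have : (1 / (a : ℝ) - 1 / l) * (l * t) = d i * t - t := by
      rw [hl]
      push_cast
      field_simp
    linarith
  have : (0 : ℝ) < 1 / l := by positivity
  linarith

theorem density_lt (Q : ℕ) (hQ : 0 < Q)
    (hw : (∑ p ∈ Q.primeFactors, Q / p) + 1 ≡ 0 [MOD Q]) :
    ∃ δ : ℝ, HasDensity (Nset Q) δ ∧ δ < 1 / nQ Q := by
  have hset : Nset Q = sifted (nQ Q) (obstruction Q) := by
    ext n
    rcases Nat.eq_zero_or_pos n with rfl | hn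
    · simp [Nset, sifted]
    · rw [mem_Nset_iff_dvd hQ hw hn]
      simp [sifted, hn]
  obtain ⟨δ, hδ⟩ := exists_hasDensity_sifted (nQ_pos Q) (fun _ => le_obstruction)
    (summable_inv_obstruction hQ)
  obtain ⟨p, hpQ, hp⟩ := Nat.exists_infinite_primes (Q + 1)
  have hndvd : ¬ p ∣ Q := Nat.not_dvd_of_pos_of_lt hQ hpQ
  exact ⟨δ, hset ▸ hδ, hδ.lt_of_sifted (nQ_pos Q) (obstruction_ne_zero hp hndvd)⟩
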